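/- Let ρ_{ijk} ≥ 0 for i,j,k ∈ {0,1} satisfy Σ_{i,j,k} ρ_{ijk} = 1 and ρ_{0jk} ≥ ρ_{1jk} for all j,k, and let m = 4·√( Σ_{j,k} (ρ_{0jk} − ρ_{1jk})² ). If m ≥ 2√2, then 1 − H({ρ_{ijk}}) + H(ρ_{000}+ρ_{011}, ρ_{001}+ρ_{010}, ρ_{100}+ρ_{111}, ρ_{101}+ρ_{110}) ≥ 1 − h( 1/2 + (1/2)·√(m²/8 − 1) ), where H is the Shannon entropy and h the binary entropy. -/

import Mathlib

open BigOperators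

/-- Shannon entropy contribution `−p·log₂ p` (with the convention `0·log₂ 0 = 0`,
which holds automatically since `Real.logb 2 0 = 0`). -/
noncomputable def ent (p : ℝ) : ℝ := -(p * Real.logb 2 p)

/-- Binary entropy `h(p) = −p log₂ p − (1−p) log₂(1−p)`. -/
noncomputable def binent (p : ℝ) : ℝ := ent p + ent (1 - p)

noncomputable def FF (x : ℝ) : ℝ := Real.binEntropy (1 / 2 + 1 / 2 * Real.sqrt x)

lemma FF_hasDeriv {x : ℝ} (h0 : 0 < x) (h1 : x < 1) :
    HasDerivAt FF (-(1/4) * ((Real.log (1 + √x) - Real.log (1 - √x)) / √x)) x := by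
  have hs0 : 0 < √x := Real.sqrt_pos.2 h0
  have hs1 : √x < 1 := by rw [Real.sqrt_lt' one_pos]; simpa using h1
  have e1 : HasDerivAt (fun x => 1 / 2 + 1 / 2 * √x) (1/2 * (1 / (2 * √x))) x :=
    ((Real.hasDerivAt_sqrt h0.ne').const_mul (1/2)).const_add (1/2)
  have e2 := Real.hasDerivAt_binEntropy (p := 1 / 2 + 1 / 2 * √x) (by linarith) (by linarith)
  have e3 := e2.comp x e1
  refine e3.congr_deriv ?_
  have a1 : 1 - (1 / 2 + 1 / 2 * √x) = (1 - √x) / 2 := by ring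
  have a2 : (1 / 2 + 1 / 2 * √x) = (1 + √x) / 2 := by ring
  rw [a1, a2, Real.log_div (by linarith) (by norm_num), Real.log_div (by linarith) (by norm_num)]
  field_simp
  ring

lemma ratio_mono {s t : ℝ} (hs : 0 < s) (hst : s ≤ t) (ht : t < 1) :
    (Real.log (1 + s) - Real.log (1 - s)) / s ≤ (Real.log (1 + t) - Real.log (1 - t)) / t := by
  have h1 := (Real.hasSum_log_sub_log_of_abs_lt_one
    (x := s) (by rw [abs_of_pos hs]; linarith)).div_const s
  have h2 := (Real.hasSum_log_sub_log_of_abs_lt_one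
    (x := t) (by rw [abs_of_pos (by linarith)]; linarith)).div_const t
  refine hasSum_le (fun k => ?_) h1 h2
  have ht0 : t ≠ 0 := by linarith
  have e : ∀ u : ℝ, u ≠ 0 → 2 * (1 / (2 * (k:ℝ) + 1)) * u ^ (2 * k + 1) / u
      = 2 * (1 / (2 * (k:ℝ) + 1)) * u ^ (2 * k) := by
    intro u hu
    rw [pow_succ, ← mul_assoc, mul_div_assoc, div_self hu, mul_one]
  rw [e s hs.ne', e t ht0]
  gcongr

lemma FF_concave : ConcaveOn ℝ (Set.Icc 0 1) FF := by
  apply AntitoneOn.concaveOn_of_deriv (convex_Icc 0 1)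
  · unfold FF
    exact (Real.binEntropy_continuous.comp (by fun_prop)).continuousOn
  · rw [interior_Icc]
    intro x hx
    exact (FF_hasDeriv hx.1 hx.2).differentiableAt.differentiableWithinAt
  · rw [interior_Icc]
    intro x hx y hy hxy
    rw [(FF_hasDeriv hx.1 hx.2).deriv, (FF_hasDeriv hy.1 hy.2).deriv]
    have := ratio_mono (Real.sqrt_pos.2 hx.1) (Real.sqrt_le_sqrt hxy)
      (by rw [Real.sqrt_lt' one_pos]; simpa using hy.2)
    linarith

lemma FF_anti {x y : ℝ} (hxy : x ≤ y) (hy : y ≤ 1) : FF y ≤ FF x := by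
  have h1 : √y ≤ 1 := by simpa using Real.sqrt_le_sqrt hy
  have h2 := Real.sqrt_le_sqrt hxy
  have h3 := Real.sqrt_nonneg x
  apply Real.binEntropy_strictAntiOn.antitoneOn
  · constructor <;> linarith
  · constructor <;> linarith
  · linarith

lemma FF_sq (s : ℝ) : FF (s ^ 2) = Real.binEntropy ((1 + s) / 2) := by
  unfold FF
  rw [Real.sqrt_sq_eq_abs]
  rcases abs_cases s with ⟨h, _⟩ | ⟨h, _⟩ <;> rw [h]
  · congr 1; ring
  · rw [← Real.binEntropy_one_sub]; congr 1; ring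

lemma ent_eq (p : ℝ) : ent p = Real.negMulLog p / Real.log 2 := by
  unfold ent Real.negMulLog Real.logb; ring

lemma binent_eq (p : ℝ) : binent p = Real.binEntropy p / Real.log 2 := by
  rw [binent, ent_eq, ent_eq, Real.binEntropy_eq_negMulLog_add_negMulLog_one_sub]; ring

lemma pair_eq {a b : ℝ} (ha : 0 ≤ a) (hb : 0 ≤ b) :
    ent a + ent b - ent (a + b) = (a + b) * FF (((a - b) / (a + b)) ^ 2) / Real.log 2 := by
  rw [ent_eq, ent_eq, ent_eq, ← add_div, ← sub_div]
  congr 1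
  rcases (add_nonneg ha hb).eq_or_lt with h | h
  · have : a = 0 := by linarith
    have : b = 0 := by linarith
    subst a; subst b; simp
  · rw [FF_sq, Real.binEntropy_eq_negMulLog_add_negMulLog_one_sub]
    have e1 : (1 + (a - b) / (a + b)) / 2 = a / (a + b) := by field_simp; ring
    have e2 : 1 - a / (a + b) = b / (a + b) := by field_simp; ring
    rw [e1, e2]
    have key : ∀ c : ℝ, (a + b) * Real.negMulLog (c / (a + b))
        = Real.negMulLog c + c * Real.log (a + b) := by
      intro c
      by_cases hc : c = 0
      · simp [hc]
      · unfold Real.negMulLog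
        rw [Real.log_div hc h.ne']; field_simp; ring
    rw [mul_add, key, key]
    unfold Real.negMulLog; ring

lemma pair_mem {a b : ℝ} (ha : 0 ≤ a) (hb : 0 ≤ b) :
    ((a - b) / (a + b)) ^ 2 ∈ Set.Icc (0:ℝ) 1 := by
  refine ⟨sq_nonneg _, ?_⟩
  rw [div_pow]
  apply div_le_one_of_le₀ _ (sq_nonneg _)
  nlinarith [mul_nonneg ha hb]

lemma pair_sq {a b : ℝ} (ha : 0 ≤ a) (hb : 0 ≤ b) (hab : a + b ≤ 1) :
    2 * (a ^ 2 + b ^ 2) - (a + b) ≤ (a + b) * ((a - b) / (a + b)) ^ 2 := by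
  rcases (add_nonneg ha hb).eq_or_lt with h | h
  · have : a = 0 := by linarith
    have : b = 0 := by linarith
    subst a; subst b; simp
  · have : (a + b) * ((a - b) / (a + b)) ^ 2 = (a - b) ^ 2 / (a + b) := by field_simp
    rw [this, le_div_iff₀ h]
    nlinarith [sq_nonneg a, sq_nonneg b]

/-- for eight nonnegative reals `ρ_{ijk}` summing to 1 with
`ρ_{0jk} ≥ ρ_{1jk}`, setting `m = 4√(Σ_{jk}(ρ_{0jk}−ρ_{1jk})²)`, if `m ≥ 2√2` then
`1 − H({ρ_{ijk}}) + H(ρ_{000}+ρ_{011}, ρ_{001}+ρ_{010}, ρ_{100}+ρ_{111}, ρ_{101}+ρ_{110})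
  ≥ 1 − h(1/2 + (1/2)√(m²/8 − 1))`. -/
theorem stmt14 (ρ : Fin 2 → Fin 2 → Fin 2 → ℝ)
    (hpos : ∀ i j k, 0 ≤ ρ i j k)
    (hsum : ∑ i, ∑ j, ∑ k, ρ i j k = 1)
    (hord : ∀ j k, ρ 1 j k ≤ ρ 0 j k)
    (m : ℝ) (hm : m = 4 * Real.sqrt (∑ j, ∑ k, (ρ 0 j k - ρ 1 j k) ^ 2))
    (hge : 2 * Real.sqrt 2 ≤ m) :
    1 - binent (1 / 2 + (1 / 2) * Real.sqrt (m ^ 2 / 8 - 1)) ≤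
      1 - (∑ i, ∑ j, ∑ k, ent (ρ i j k))
        + (ent (ρ 0 0 0 + ρ 0 1 1) + ent (ρ 0 0 1 + ρ 0 1 0)
          + ent (ρ 1 0 0 + ρ 1 1 1) + ent (ρ 1 0 1 + ρ 1 1 0)) := by
  have p000 := hpos 0 0 0
  have p001 := hpos 0 0 1
  have p010 := hpos 0 1 0
  have p011 := hpos 0 1 1
  have p100 := hpos 1 0 0
  have p101 := hpos 1 0 1
  have p110 := hpos 1 1 0
  have p111 := hpos 1 1 1
  have o00 := hord 0 0
  have o01 := hord 0 1
  have o10 := hord 1 0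
  have o11 := hord 1 1
  have hm2 : m ^ 2 = 16 * (∑ j, ∑ k, (ρ 0 j k - ρ 1 j k) ^ 2) := by
    rw [hm, mul_pow, Real.sq_sqrt (by positivity)]; norm_num
  simp only [Fin.sum_univ_two] at hsum hm2 ⊢
  clear hm hge hpos hord
  generalize ρ 0 0 0 = a at *
  generalize ρ 0 1 1 = b at *
  generalize ρ 0 0 1 = c at *
  generalize ρ 0 1 0 = d at *
  generalize ρ 1 0 0 = a' at *
  generalize ρ 1 1 1 = b' at *
  generalize ρ 1 0 1 = c' at *
  generalize ρ 1 1 0 = d' at *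
  have hlog : 0 < Real.log 2 := Real.log_pos (by norm_num)
  have q1 := pair_eq p000 p011
  have q2 := pair_eq p001 p010
  have q3 := pair_eq p100 p111
  have q4 := pair_eq p101 p110
  have r1 := pair_sq p000 p011 (by linarith)
  have r2 := pair_sq p001 p010 (by linarith)
  have r3 := pair_sq p100 p111 (by linarith)
  have r4 := pair_sq p101 p110 (by linarith)
  have s1 := pair_mem p000 p011
  have s2 := pair_mem p001 p010
  have s3 := pair_mem p100 p111
  have s4 := pair_mem p101 p110
  generalize ((a - b) / (a + b)) ^ 2 = x1 at *
  generalize ((c - d) / (c + d)) ^ 2 = x2 at *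
  generalize ((a' - b') / (a' + b')) ^ 2 = x3 at *
  generalize ((c' - d') / (c' + d')) ^ 2 = x4 at *
  have J := FF_concave.le_map_sum (t := Finset.univ)
    (w := ![a + b, c + d, a' + b', c' + d']) (p := ![x1, x2, x3, x4])
    (by intro i _; fin_cases i <;> simp <;> linarith)
    (by simp [Fin.sum_univ_four]; linarith)
    (by intro i _; fin_cases i <;> simp <;> first | exact s1 | exact s2 | exact s3 | exact s4)
  simp [Fin.sum_univ_four] at J
  have hX : m ^ 2 / 8 - 1 ≤ (a + b) * x1 + (c + d) * x2 + (a' + b') * x3 + (c' + d') * x4 := by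
    rw [hm2]
    nlinarith [mul_nonneg p100 (sub_nonneg.2 o00), mul_nonneg p101 (sub_nonneg.2 o01),
      mul_nonneg p110 (sub_nonneg.2 o10), mul_nonneg p111 (sub_nonneg.2 o11),
      sq_nonneg a', sq_nonneg b', sq_nonneg c', sq_nonneg d']
  have hX1 : (a + b) * x1 + (c + d) * x2 + (a' + b') * x3 + (c' + d') * x4 ≤ 1 := by
    have t1 := mul_le_mul_of_nonneg_left s1.2 (add_nonneg p000 p011)
    have t2 := mul_le_mul_of_nonneg_left s2.2 (add_nonneg p001 p010)
    have t3 := mul_le_mul_of_nonneg_left s3.2 (add_nonneg p100 p111)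
    have t4 := mul_le_mul_of_nonneg_left s4.2 (add_nonneg p101 p110)
    linarith
  have hF := J.trans (FF_anti hX hX1)
  have hD := div_le_div_of_nonneg_right hF hlog.le
  rw [add_div, add_div, add_div] at hD
  rw [binent_eq]
  change 1 - FF (m ^ 2 / 8 - 1) / Real.log 2 ≤ _
  linarith
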